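/- Let β > 1 be a real number whose (−β)-expansion of l_β is finite of the form d_1 d_2 … d_m 0^ω (i.e., the digit sequence d_1 d_2 d_3 … of l_β satisfies d_i = 0 for all i > m). Then β is a root of the polynomial P(x) = (−x)^{m+1} + d_1(−x)^m + (d_2 − d_1)(−x)^{m−1} + ⋯ + (d_m − d_{m−1})(−x) − d_m; in particular β is an algebraic integer of degree at most m + 1. -/

import Mathlib

/-- `l_β = -β/(β+1)` -/
noncomputable def ISl (β : ℝ) : ℝ := -β / (β + 1)

/-- The Ito–Sadahiro transformation `T(x) = -βx - ⌊-βx - l_β⌋`. -/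
noncomputable def IST (β : ℝ) (x : ℝ) : ℝ := -β * x - ⌊-β * x - ISl β⌋

/-- The `i`-th `(-β)`-digit of `x` (for `i ≥ 1`): `x_i = ⌊-β T^{i-1}(x) - l_β⌋`. -/
noncomputable def ISdigit (β x : ℝ) (i : ℕ) : ℤ := ⌊-β * (IST β)^[i - 1] x - ISl β⌋

open Polynomial in
/-- If `-x` is a root of a monic integer polynomial of degree `n + 1`, given by its leading term
and a remainder of degree at most `n`, then `x` is integral of degree at most `n + 1`. -/
theorem isIntegral_and_natDegree_minpoly_le_of_neg_root {x : ℝ} {n : ℕ} {r : ℤ[X]}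
    (hr : r.natDegree ≤ n) (h : (-x) ^ (n + 1) + aeval (-x) r = 0) :
    IsIntegral ℤ x ∧ (minpoly ℚ x).natDegree ≤ n + 1 := by
  have hdeg : r.degree < ((n + 1 : ℕ) : WithBot ℕ) :=
    (natDegree_le_iff_degree_le.1 hr).trans_lt (by exact_mod_cast n.lt_succ_self)
  set q : ℤ[X] := X ^ (n + 1) + r with hq
  have hmonic : q.Monic := monic_X_pow_add hdeg
  have hroot : aeval (-x) q = 0 := by simpa [hq] using h
  refine ⟨neg_neg x ▸ IsIntegral.neg ⟨q, hmonic, hroot⟩, ?_⟩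
  have hqdeg : q.natDegree = n + 1 := by
    rw [hq, natDegree_add_eq_left_of_degree_lt (by simpa using hdeg), natDegree_X_pow]
  set p : ℚ[X] := (q.map (algebraMap ℤ ℚ)).comp (-X) with hp
  have hpdeg : p.natDegree = n + 1 := by
    rw [hp, natDegree_comp, natDegree_neg, natDegree_X, mul_one, hmonic.natDegree_map, hqdeg]
  have hp0 : p ≠ 0 := ne_zero_of_natDegree_gt (n := 0) (by omega)
  have hproot : aeval x p = 0 := by
    rw [hp, aeval_comp, map_neg, aeval_X, aeval_map_algebraMap, hroot]
  exact hpdeg ▸ natDegree_le_natDegree (minpoly.degree_le_of_ne_zero ℚ x hp0 hproot)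

theorem ISl_le_IST (β x : ℝ) : ISl β ≤ IST β x := by
  have := Int.floor_le (-β * x - ISl β)
  unfold IST
  linarith

theorem IST_lt_ISl_add_one (β x : ℝ) : IST β x < ISl β + 1 := by
  have := Int.lt_floor_add_one (-β * x - ISl β)
  unfold IST
  linarith

theorem iterate_IST_succ (β x : ℝ) (n : ℕ) :
    (IST β)^[n + 1] x = -β * (IST β)^[n] x - ISdigit β x (n + 1) := by
  rw [Function.iterate_succ_apply']
  simp [IST, ISdigit]

/-- Once all later digits vanish, the orbit has reached `0`. -/
theorem iterate_IST_eq_zero {β x : ℝ} (hβ : 1 < β) {m : ℕ}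
    (hfin : ∀ i, m < i → ISdigit β x i = 0) : (IST β)^[m] x = 0 := by
  have hpow (k : ℕ) : (IST β)^[m + k] x = (-β) ^ k * (IST β)^[m] x := by
    induction k with
    | zero => simp
    | succ k ih =>
      rw [← add_assoc, iterate_IST_succ, ih, hfin _ (by omega)]
      push_cast
      ring
  by_contra hne
  have hpos : 0 < |(IST β)^[m] x| := abs_pos.2 hne
  obtain ⟨k, hk⟩ := pow_unbounded_of_one_lt ((|ISl β| + 1) / |(IST β)^[m] x|) hβ
  rw [div_lt_iff₀ hpos] at hk
  have hbound : |(IST β)^[m + (k + 1)] x| ≤ |ISl β| + 1 := by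
    rw [← add_assoc, Function.iterate_succ_apply', abs_le]
    constructor
    · linarith [ISl_le_IST β ((IST β)^[m + k] x), neg_abs_le (ISl β)]
    · linarith [IST_lt_ISl_add_one β ((IST β)^[m + k] x), le_abs_self (ISl β)]
  rw [hpow, abs_mul, abs_pow, abs_neg, abs_of_pos (by linarith : 0 < β)] at hbound
  have hle : β ^ k ≤ β ^ (k + 1) := pow_le_pow_right₀ hβ.le k.le_succ
  nlinarith [mul_le_mul_of_nonneg_right hle hpos.le]

/-- The orbit of `l_β` in terms of the digits of `l_β`. -/
theorem add_one_mul_iterate_IST_ISl {β : ℝ} (hβ : 1 < β) {d : ℕ → ℤ} (hd0 : d 0 = 0)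
    (hd : ∀ i : ℕ, 1 ≤ i → d i = ISdigit β (ISl β) i) (n : ℕ) :
    (β + 1) * (IST β)^[n] (ISl β) = (-β) ^ (n + 1)
      + (∑ i ∈ Finset.Icc 1 n, ((d i : ℝ) - (d (i - 1) : ℝ)) * (-β) ^ (n + 1 - i))
      - (d n : ℝ) := by
  induction n with
  | zero =>
    have : β + 1 ≠ 0 := by linarith
    simp [hd0, ISl]
    field_simp
  | succ n ih =>
    have hsum : ∑ i ∈ Finset.Icc 1 n, ((d i : ℝ) - (d (i - 1) : ℝ)) * (-β) ^ (n + 1 + 1 - i)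
        = -β * ∑ i ∈ Finset.Icc 1 n, ((d i : ℝ) - (d (i - 1) : ℝ)) * (-β) ^ (n + 1 - i) := by
      rw [Finset.mul_sum]
      refine Finset.sum_congr rfl fun i hi => ?_
      rw [Nat.succ_sub (by grind : i ≤ n + 1), pow_succ]
      ring
    rw [iterate_IST_succ, ← hd _ (by omega), Finset.sum_Icc_succ_top (by omega), hsum,
      Nat.add_sub_cancel_left, Nat.add_sub_cancel]
    linear_combination -β * ih

/-- If the `(-β)`-expansion of `l_β` is finite, of the form `d_1 d_2 ⋯ d_m 0^ω`, then `β` is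
a root of `P(x) = (-x)^{m+1} + d_1(-x)^m + (d_2-d_1)(-x)^{m-1} + ⋯ + (d_m-d_{m-1})(-x) - d_m`
(written below with the convention `d_0 = 0`, so that
`P(x) = (-x)^{m+1} + ∑_{i=1}^{m}(d_i - d_{i-1})(-x)^{m+1-i} - d_m`); in particular `β` is an
algebraic integer of degree at most `m + 1`. -/
theorem ito_sadahiro_finite_expansion_polynomial (β : ℝ) (hβ : 1 < β) (m : ℕ)
    (d : ℕ → ℤ) (hd0 : d 0 = 0) (hd : ∀ i : ℕ, 1 ≤ i → d i = ISdigit β (ISl β) i)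
    (hfin : ∀ i : ℕ, m < i → d i = 0) :
    ((-β) ^ (m + 1)
        + (∑ i ∈ Finset.Icc 1 m, ((d i : ℝ) - (d (i - 1) : ℝ)) * (-β) ^ (m + 1 - i))
        - (d m : ℝ) = 0)
      ∧ IsIntegral ℤ β ∧ (minpoly ℚ β).natDegree ≤ m + 1 := by
  have hroot := add_one_mul_iterate_IST_ISl hβ hd0 hd m
  rw [iterate_IST_eq_zero hβ fun i hi => by rw [← hd i (by omega), hfin i hi], mul_zero] at hroot
  refine ⟨hroot.symm, isIntegral_and_natDegree_minpoly_le_of_neg_root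
    (r := (∑ i ∈ Finset.Icc 1 m, Polynomial.C (d i - d (i - 1)) * Polynomial.X ^ (m + 1 - i)) - Polynomial.C (d m)) ?_ ?_⟩
  · refine (Polynomial.natDegree_sub_le _ _).trans (max_le
      (Polynomial.natDegree_sum_le_of_forall_le _ _ fun i hi => ?_) (by simp))
    exact (Polynomial.natDegree_C_mul_X_pow_le _ _).trans (by grind)
  · simp only [map_sub, map_sum, map_mul, map_pow, Polynomial.aeval_X, eq_intCast]
    rw [← add_sub_assoc]
    simpa using hroot.symm
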